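/- Let s = [[0,0,1],[0,1,0],[1,0,0]], let α : GL₃(F) → GL₃(F) be the automorphism g^α = s⁻¹·(g⁻¹)ᵀ·s, and define α̂ : H → H by h(a,x,y)^α̂ = h(a, y²/2 − x, a·y). Then: (i) for every h ∈ H, the image of the coset Dh under α equals the coset D·h^α̂ (as subsets of G); and (ii) for every x ∈ F and every t ∈ F\{0}, the image of S_x under α̂ is S_{−x}, the image of C_t under α̂ is C_t, and the image of P_x under α̂ is P_{−x}. -/

import Mathlib

open Matrix Pointwise

abbrev GL3 (F : Type*) [Field F] := Matrix.GeneralLinearGroup (Fin 3) F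

variable (F : Type*) [Field F]

/-- The subgroup `G`, as a set of invertible matrices. -/
def GSetGL : Set (GL3 F) :=
  {g | ∃ a b c x y z : F, (a = 1 ∨ a = -1) ∧ (b = 1 ∨ b = -1) ∧ (c = 1 ∨ c = -1) ∧
    a * b * c = 1 ∧ (g : Matrix (Fin 3) (Fin 3) F) = !![a, x, z; 0, b, y; 0, 0, c]}

/-- The subgroup `D`, as a set of invertible matrices. -/
def DSetGL : Set (GL3 F) :=
  {g | ∃ a x : F, (a = 1 ∨ a = -1) ∧
    (g : Matrix (Fin 3) (Fin 3) F) = !![a, a * x, a * x ^ 2 / 2; 0, 1, x; 0, 0, a]}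

/-- The matrix `h(a,x,y)`. -/
def hMat (a x y : F) : Matrix (Fin 3) (Fin 3) F := !![a, 0, x; 0, a, y; 0, 0, 1]

/-- The subgroup `H`, as a set of invertible matrices. -/
def HSetGL : Set (GL3 F) :=
  {g | ∃ a x y : F, (a = 1 ∨ a = -1) ∧ (g : Matrix (Fin 3) (Fin 3) F) = hMat F a x y}

/-- The subgroup `K`, as a set of invertible matrices. -/
def KSetGL : Set (GL3 F) :=
  {g | ∃ a x y : F, (a = 1 ∨ a = -1) ∧
    (g : Matrix (Fin 3) (Fin 3) F) = !![1, x, y; 0, a, 0; 0, 0, a]}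

/-- The matrix `s`. -/
def sMat : Matrix (Fin 3) (Fin 3) F := !![0, 0, 1; 0, 1, 0; 1, 0, 0]

/-- The singleton set `S_t = {h(1,t,0)}`. -/
def SorbGL (t : F) : Set (GL3 F) := {g | (g : Matrix (Fin 3) (Fin 3) F) = hMat F 1 t 0}

/-- The set `C_t = {h(1,z,t) : z ∈ F}`. -/
def CorbGL (t : F) : Set (GL3 F) :=
  {g | ∃ z : F, (g : Matrix (Fin 3) (Fin 3) F) = hMat F 1 z t}

/-- The parabolic set `P_t = {h(-1,t+z²,2z) : z ∈ F}`. -/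
def PorbGL (t : F) : Set (GL3 F) :=
  {g | ∃ z : F, (g : Matrix (Fin 3) (Fin 3) F) = hMat F (-1) (t + z ^ 2) (2 * z)}

/-- The graph of the map `α̂ : H → H`, `h(a,x,y) ↦ h(a, y²/2 - x, a·y)`. -/
def alphaHatRel (g g' : GL3 F) : Prop :=
  ∃ a x y : F, (a = 1 ∨ a = -1) ∧ (g : Matrix (Fin 3) (Fin 3) F) = hMat F a x y ∧
    (g' : Matrix (Fin 3) (Fin 3) F) = hMat F a (y ^ 2 / 2 - x) (a * y)

section Auxiliary

variable {F : Type*} [Field F]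

/-- The general element of `D`. -/
def dMat (a x : F) : Matrix (Fin 3) (Fin 3) F :=
  !![a, a * x, a * x ^ 2 / 2; 0, 1, x; 0, 0, a]

lemma sq_of_sign {a : F} (ha : a = 1 ∨ a = -1) : a * a = 1 := by
  rcases ha with rfl | rfl <;> ring

lemma sign_mul_sign {a b : F} (ha : a = 1 ∨ a = -1) (hb : b = 1 ∨ b = -1) :
    a * b = 1 ∨ a * b = -1 := by
  rcases ha with rfl | rfl <;> rcases hb with rfl | rfl <;> simp

lemma dMat_mul (h2 : (2 : F) ≠ 0) {a b : F} (ha : a = 1 ∨ a = -1) (hb : b = 1 ∨ b = -1)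
    (x y : F) : dMat a x * dMat b y = dMat (a * b) (y + b * x) := by
  ext i j
  fin_cases i <;> fin_cases j <;> rcases ha with rfl | rfl <;> rcases hb with rfl | rfl <;>
    simp [dMat, Matrix.mul_apply, Fin.sum_univ_three] <;> field_simp <;> ring

lemma coe_inv_eq_of_mul_eq_one {g : GL3 F} {A B : Matrix (Fin 3) (Fin 3) F}
    (hg : (g : Matrix (Fin 3) (Fin 3) F) = A) (h : A * B = 1) :
    ((g⁻¹ : GL3 F) : Matrix (Fin 3) (Fin 3) F) = B := by
  rw [Matrix.coe_units_inv, hg]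
  exact Matrix.inv_eq_right_inv h

lemma coe_inv_of_coe_eq_dMat (h2 : (2 : F) ≠ 0) {a x : F} (ha : a = 1 ∨ a = -1) {g : GL3 F}
    (hg : (g : Matrix (Fin 3) (Fin 3) F) = dMat a x) :
    ((g⁻¹ : GL3 F) : Matrix (Fin 3) (Fin 3) F) = dMat a (-(a * x)) := by
  refine coe_inv_eq_of_mul_eq_one hg ?_
  rw [dMat_mul h2 ha ha, sq_of_sign ha]
  ext i j
  fin_cases i <;> fin_cases j <;> simp [dMat]

/-- `D` as a subgroup of `GL₃(F)`. -/
def dSubgroup (h2 : (2 : F) ≠ 0) : Subgroup (GL3 F) where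
  carrier := DSetGL F
  one_mem' := ⟨1, 0, Or.inl rfl, by
    ext i j; fin_cases i <;> fin_cases j <;> simp⟩
  mul_mem' := by
    rintro g k ⟨a, x, ha, hg⟩ ⟨b, y, hb, hk⟩
    refine ⟨a * b, y + b * x, sign_mul_sign ha hb, ?_⟩
    rw [Units.val_mul, hg, hk]
    exact dMat_mul h2 ha hb x y
  inv_mem' := by
    rintro g ⟨a, x, ha, hg⟩
    exact ⟨a, -(a * x), ha, coe_inv_of_coe_eq_dMat h2 ha hg⟩

lemma sMat_inv : (sMat F)⁻¹ = sMat F := by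
  refine Matrix.inv_eq_right_inv ?_
  ext i j
  fin_cases i <;> fin_cases j <;> simp [sMat, Matrix.mul_apply, Fin.sum_univ_three]

lemma sMat_conj_transpose (a b c d e f g h i : F) :
    (sMat F)⁻¹ * (!![a, b, c; d, e, f; g, h, i])ᵀ * sMat F = !![i, f, c; h, e, b; g, d, a] := by
  rw [sMat_inv]
  ext i j
  fin_cases i <;> fin_cases j <;>
    simp [sMat, Matrix.mul_apply, Matrix.vecMul_eq_sum, Fin.sum_univ_three]

lemma coe_inv_of_coe_eq_hMat {a x y : F} (ha : a = 1 ∨ a = -1) {g : GL3 F}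
    (hg : (g : Matrix (Fin 3) (Fin 3) F) = hMat F a x y) :
    ((g⁻¹ : GL3 F) : Matrix (Fin 3) (Fin 3) F) = hMat F a (-(a * x)) (-(a * y)) := by
  refine coe_inv_eq_of_mul_eq_one hg ?_
  ext i j
  fin_cases i <;> fin_cases j <;> rcases ha with rfl | rfl <;>
    simp [hMat, Matrix.mul_apply, Fin.sum_univ_three]

lemma exists_coe_eq_hMat {a : F} (ha : a = 1 ∨ a = -1) (x y : F) :
    ∃ g : GL3 F, (g : Matrix (Fin 3) (Fin 3) F) = hMat F a x y := by
  refine ⟨Matrix.GeneralLinearGroup.mkOfDetNeZero (hMat F a x y) ?_, rfl⟩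
  rcases ha with rfl | rfl <;> simp [hMat, Matrix.det_fin_three]

lemma exists_coe_eq_dMat {a : F} (ha : a = 1 ∨ a = -1) (x : F) :
    ∃ g : GL3 F, (g : Matrix (Fin 3) (Fin 3) F) = dMat a x := by
  refine ⟨Matrix.GeneralLinearGroup.mkOfDetNeZero (dMat a x) ?_, rfl⟩
  rcases ha with rfl | rfl <;> simp [dMat, Matrix.det_fin_three]

lemma hMat_inj {a x y a' x' y' : F} :
    hMat F a x y = hMat F a' x' y' ↔ a = a' ∧ x = x' ∧ y = y' := by
  constructor
  · intro h
    exact ⟨by simpa [hMat] using congrFun (congrFun h 0) 0,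
      by simpa [hMat] using congrFun (congrFun h 0) 2,
      by simpa [hMat] using congrFun (congrFun h 1) 2⟩
  · rintro ⟨rfl, rfl, rfl⟩
    rfl

lemma alphaHatRel_iff {a x y : F} (ha : a = 1 ∨ a = -1) {g g' : GL3 F}
    (hg : (g : Matrix (Fin 3) (Fin 3) F) = hMat F a x y) :
    alphaHatRel F g g' ↔
      (g' : Matrix (Fin 3) (Fin 3) F) = hMat F a (y ^ 2 / 2 - x) (a * y) := by
  constructor
  · rintro ⟨b, u, v, -, hg₁, hg'⟩
    obtain ⟨rfl, rfl, rfl⟩ := hMat_inj.1 (hg.symm.trans hg₁)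
    exact hg'
  · exact fun hg' => ⟨a, x, y, ha, hg, hg'⟩

/-- The image under `α̂` of a family `h(a, u z, v z)`. -/
lemma exists_alphaHatRel_iff {ι : Type*} {a : F} (ha : a = 1 ∨ a = -1) (u v : ι → F)
    (g' : GL3 F) :
    (∃ g : GL3 F, (∃ z, (g : Matrix (Fin 3) (Fin 3) F) = hMat F a (u z) (v z)) ∧
      alphaHatRel F g g') ↔
    ∃ z, (g' : Matrix (Fin 3) (Fin 3) F) = hMat F a (v z ^ 2 / 2 - u z) (a * v z) := by
  constructor
  · rintro ⟨g, ⟨z, hg⟩, h⟩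
    exact ⟨z, (alphaHatRel_iff ha hg).1 h⟩
  · rintro ⟨z, hg'⟩
    obtain ⟨g, hg⟩ := exists_coe_eq_hMat ha (u z) (v z)
    exact ⟨g, ⟨z, hg⟩, (alphaHatRel_iff ha hg).2 hg'⟩

/-- `α` is the automorphism `g ↦ s⁻¹ (g⁻¹)ᵀ s`. -/
abbrev IsConjInvTranspose (α : GL3 F ≃* GL3 F) : Prop :=
  ∀ g : GL3 F, ((α g : GL3 F) : Matrix (Fin 3) (Fin 3) F) =
    (sMat F)⁻¹ * ((g⁻¹ : GL3 F) : Matrix (Fin 3) (Fin 3) F)ᵀ * sMat F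

variable {α : GL3 F ≃* GL3 F}

lemma coe_map_of_coe_eq_dMat (hα : IsConjInvTranspose α) (h2 : (2 : F) ≠ 0)
    {a x : F} (ha : a = 1 ∨ a = -1) {g : GL3 F}
    (hg : (g : Matrix (Fin 3) (Fin 3) F) = dMat a x) :
    ((α g : GL3 F) : Matrix (Fin 3) (Fin 3) F) = dMat a (-x) := by
  rw [hα, coe_inv_of_coe_eq_dMat h2 ha hg, dMat, sMat_conj_transpose]
  ext i j
  fin_cases i <;> fin_cases j <;> rcases ha with rfl | rfl <;> simp [dMat]

lemma image_DSetGL (hα : IsConjInvTranspose α) (h2 : (2 : F) ≠ 0) : α '' DSetGL F = DSetGL F := by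
  ext k
  constructor
  · rintro ⟨g, ⟨a, x, ha, hg⟩, rfl⟩
    exact ⟨a, -x, ha, coe_map_of_coe_eq_dMat hα h2 ha hg⟩
  · rintro ⟨a, x, ha, hk⟩
    obtain ⟨g, hg⟩ := exists_coe_eq_dMat ha (-x)
    refine ⟨g, ⟨a, -x, ha, hg⟩, Units.ext ?_⟩
    rw [coe_map_of_coe_eq_dMat hα h2 ha hg, hk, neg_neg, dMat]

lemma exists_map_eq_mul (hα : IsConjInvTranspose α) (h2 : (2 : F) ≠ 0)
    {g g' : GL3 F} (h : alphaHatRel F g g') :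
    ∃ d ∈ DSetGL F, α g = d * g' := by
  obtain ⟨a, x, y, ha, hg, hg'⟩ := h
  obtain ⟨d, hd⟩ := exists_coe_eq_dMat ha (-(a * y))
  refine ⟨d, ⟨a, _, ha, hd⟩, Units.ext ?_⟩
  rw [hα, Units.val_mul, hd, hg', coe_inv_of_coe_eq_hMat ha hg, hMat, sMat_conj_transpose]
  ext i j
  fin_cases i <;> fin_cases j <;> rcases ha with rfl | rfl <;>
    simp [dMat, hMat, Matrix.mul_apply, Fin.sum_univ_three] <;> field_simp <;> ring

lemma image_DSetGL_mul_singleton (hα : IsConjInvTranspose α) (h2 : (2 : F) ≠ 0)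
    {g g' : GL3 F} (h : alphaHatRel F g g') :
    α '' (DSetGL F * {g}) = DSetGL F * {g'} := by
  obtain ⟨d, hd, hdg⟩ := exists_map_eq_mul hα h2 h
  have hD : DSetGL F * {d} = DSetGL F := by
    rw [Set.mul_singleton]
    exact op_smul_coe_set (s := dSubgroup h2) hd
  rw [Set.image_mul, image_DSetGL hα h2, Set.image_singleton, hdg, ← Set.singleton_mul_singleton,
    ← mul_assoc, hD]

end Auxiliary

theorem stmt14 (F : Type*) [Field F] [Fintype F] (hodd : Odd (Fintype.card F))
    (α : GL3 F ≃* GL3 F)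
    (hα : ∀ g : GL3 F,
      ((α g : GL3 F) : Matrix (Fin 3) (Fin 3) F) =
        (sMat F)⁻¹ * ((g⁻¹ : GL3 F) : Matrix (Fin 3) (Fin 3) F)ᵀ * sMat F) :
    -- (i) `(Dh)^α = D·h^α̂` for every `h ∈ H`
    (∀ g g' : GL3 F, alphaHatRel F g g' →
      α '' (DSetGL F * ({g} : Set (GL3 F))) = DSetGL F * ({g'} : Set (GL3 F))) ∧
    -- (ii) `α̂` maps `S_x` to `S_{-x}`, `C_t` to `C_t`, and `P_x` to `P_{-x}`
    (∀ x : F, {g' : GL3 F | ∃ g ∈ SorbGL F x, alphaHatRel F g g'} = SorbGL F (-x)) ∧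
    (∀ t : F, t ≠ 0 → {g' : GL3 F | ∃ g ∈ CorbGL F t, alphaHatRel F g g'} = CorbGL F t) ∧
    (∀ x : F, {g' : GL3 F | ∃ g ∈ PorbGL F x, alphaHatRel F g g'} = PorbGL F (-x)) := by
  have h2 : (2 : F) ≠ 0 := by
    refine Ring.two_ne_zero fun h => ?_
    have := FiniteField.even_card_of_char_two h
    rw [Nat.odd_iff] at hodd
    omega
  refine ⟨fun g g' h => image_DSetGL_mul_singleton hα h2 h, fun x => ?_, fun t _ => ?_,
    fun x => ?_⟩ <;> ext g'
  · have h := exists_alphaHatRel_iff (ι := Unit) (Or.inl rfl) (fun _ => x) (fun _ => 0) g'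
    simpa [SorbGL] using h
  · refine (exists_alphaHatRel_iff (Or.inl rfl) (fun z => z) (fun _ => t) g').trans ?_
    simp only [CorbGL, Set.mem_ofPred_eq, one_mul]
    exact (Equiv.subLeft (t ^ 2 / 2)).exists_congr_right
      (q := fun z => (g' : Matrix (Fin 3) (Fin 3) F) = hMat F 1 z t)
  · refine (exists_alphaHatRel_iff (Or.inr rfl) (fun z => x + z ^ 2) (fun z => 2 * z) g').trans ?_
    have hz : ∀ z : F, (2 * z) ^ 2 / 2 - (x + z ^ 2) = -x + z ^ 2 := fun z => by
      field_simp
      ring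
    simp only [hz]
    rw [PorbGL, Set.mem_ofPred_eq, ← (Equiv.neg F).exists_congr_right]
    simp
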